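/- arXiv:0812.2291 — 2 statements merged into one kernel-verified Lean document; each statement's English description precedes it below -/
import Mathlib

section
/- Let A be a non-degenerate, scale-free deterministic allocation rule satisfying IIA for the MAB mechanism design problem with k agents and T rounds. Then there exists a payment rule P such that the mechanism (A,P) is normalized and truthful if and only if A is pointwise monotone and exploration-separated. -/
open Finset

namespace MAB

/-- A realization of clicks: for each agent and each round, whether the agent
would be clicked if shown at that round. -/
abbrev Realization (k T : ℕ) := Fin k → Fin T → Bool

/-- A deterministic allocation rule: maps a bid profile, a realization and a round
to the agent chosen at that round. -/
abbrev Alloc (k T : ℕ) := (Fin k → ℝ) → Realization k T → Fin T → Fin k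

/-- A payment rule: maps a bid profile and a realization to the payment
charged to each agent. -/
abbrev Payment (k T : ℕ) := (Fin k → ℝ) → Realization k T → Fin k → ℝ

variable {k T : ℕ}

/-- A bid profile consists of positive reals. -/
def PosBids (b : Fin k → ℝ) : Prop := ∀ i, 0 < b i

/-- The allocation rule is online: the choice at round `t` is determined by the bids
and the bits observed at rounds `s < t`. -/
def Online (A : Alloc k T) : Prop :=
  ∀ (b : Fin k → ℝ) (ρ ρ' : Realization k T) (t : Fin T),
    (∀ s : Fin T, s < t → ρ (A b ρ s) s = ρ' (A b ρ s) s) → A b ρ t = A b ρ' t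

/-- The click-allocation: the number of rounds in which agent `i` is chosen and clicked. -/
def clicks (A : Alloc k T) (b : Fin k → ℝ) (ρ : Realization k T) (i : Fin k) : ℕ :=
  (univ.filter fun t : Fin T => A b ρ t = i ∧ ρ i t = true).card

/-- The payment rule only uses clicks actually observed by the allocation rule. -/
def PaymentObservable (A : Alloc k T) (P : Payment k T) : Prop :=
  ∀ (b : Fin k → ℝ) (ρ ρ' : Realization k T),
    (∀ t : Fin T, ρ (A b ρ t) t = ρ' (A b ρ t) t) → P b ρ = P b ρ'

/-- The mechanism is normalized: `0 ≤ P_i(b;ρ) ≤ b_i · C_i(b;ρ)`. -/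
def Normalized (A : Alloc k T) (P : Payment k T) : Prop :=
  ∀ (b : Fin k → ℝ) (ρ : Realization k T) (i : Fin k), PosBids b →
    0 ≤ P b ρ i ∧ P b ρ i ≤ b i * (clicks A b ρ i : ℝ)

/-- The mechanism is truthful: bidding the true value dominates any other bid. -/
def Truthful (A : Alloc k T) (P : Payment k T) : Prop :=
  ∀ (b : Fin k → ℝ) (ρ : Realization k T) (i : Fin k) (v : ℝ), PosBids b → 0 < v →
    v * (clicks A (Function.update b i v) ρ i : ℝ) - P (Function.update b i v) ρ i ≥
      v * (clicks A b ρ i : ℝ) - P b ρ i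

/-- Pointwise monotonicity: an agent that is played keeps the impression
after increasing her bid. -/
def PointwiseMonotone (A : Alloc k T) : Prop :=
  ∀ (b : Fin k → ℝ) (ρ : Realization k T) (t : Fin T) (i : Fin k) (x : ℝ),
    PosBids b → A b ρ t = i → b i < x → A (Function.update b i x) ρ t = i

/-- `flip ρ i t` is `ρ ⊕ 1(i,t)`: the realization with the bit of agent `i`
at round `t` flipped. -/
def flip (ρ : Realization k T) (i : Fin k) (t : Fin T) : Realization k T :=
  fun j s => if j = i ∧ s = t then !(ρ j s) else ρ j s

/-- Round `t` is `(b;ρ)`-influential. -/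
def InfluentialAt (A : Alloc k T) (b : Fin k → ℝ) (ρ : Realization k T) (t : Fin T) : Prop :=
  ∃ t' : Fin T, t < t' ∧ A b ρ t' ≠ A b (flip ρ (A b ρ t) t) t'

/-- Round `t` is influential for realization `ρ`. -/
def Influential (A : Alloc k T) (ρ : Realization k T) (t : Fin T) : Prop :=
  ∃ b : Fin k → ℝ, PosBids b ∧ InfluentialAt A b ρ t

/-- The allocation rule is exploration-separated: in any influential round
the allocation does not depend on the bids. -/
def ExplorationSeparated (A : Alloc k T) : Prop :=
  ∀ (ρ : Realization k T) (t : Fin T), Influential A ρ t →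
    ∀ b b' : Fin k → ℝ, PosBids b → PosBids b' → A b ρ t = A b' ρ t

/-- Round `t` is `(b;ρ)`-influential with influenced agent `i`. -/
def InfluencedAgent (A : Alloc k T) (b : Fin k → ℝ) (ρ : Realization k T) (t : Fin T)
    (i : Fin k) : Prop :=
  ∃ t' : Fin T, t < t' ∧ A b ρ t' ≠ A b (flip ρ (A b ρ t) t) t' ∧
    (i = A b ρ t' ∨ i = A b (flip ρ (A b ρ t) t) t')

/-- Round `t` is `(b;ρ)`-secured from agent `i`. -/
def SecuredFrom (A : Alloc k T) (b : Fin k → ℝ) (ρ : Realization k T) (t : Fin T)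
    (i : Fin k) : Prop :=
  ∀ x : ℝ, b i < x → A (Function.update b i x) ρ t = A b ρ t

/-- The allocation rule is weakly separated. -/
def WeaklySeparated (A : Alloc k T) : Prop :=
  ∀ (b : Fin k → ℝ) (ρ : Realization k T) (t : Fin T) (i : Fin k),
    PosBids b → InfluencedAgent A b ρ t i → SecuredFrom A b ρ t i

/-- Non-degeneracy of the allocation rule. -/
def NonDegenerate (A : Alloc k T) : Prop :=
  ∀ (b : Fin k → ℝ) (ρ : Realization k T) (t t' : Fin T), PosBids b → t ≤ t' →
    ∃ l u : ℝ, l < u ∧ l ≤ b (A b ρ t) ∧ b (A b ρ t) ≤ u ∧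
      ∀ x ∈ Set.Icc l u, ∀ φ ∈ ({ρ, flip ρ (A b ρ t) t} : Set (Realization k T)),
        ∀ s ∈ ({t, t'} : Set (Fin T)),
          (A (Function.update b (A b ρ t) x) φ s = A b ρ t ↔ A b φ s = A b ρ t)

/-- The allocation rule is scale-free. -/
def ScaleFree (A : Alloc k T) : Prop :=
  ∀ (c : ℝ) (b : Fin k → ℝ) (ρ : Realization k T) (t : Fin T), 0 < c → PosBids b →
    A (fun j => c * b j) ρ t = A b ρ t

/-- Independence of irrelevant alternatives. -/
def IIA (A : Alloc k T) : Prop :=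
  ∀ (b : Fin k → ℝ) (ρ : Realization k T) (t : Fin T) (i : Fin k) (x : ℝ),
    PosBids b → 0 < x → A b ρ t ≠ A (Function.update b i x) ρ t →
    (A b ρ t = i ∨ A (Function.update b i x) ρ t = i)

/-- Round `t` is bid-independent w.r.t. realization `ρ`. -/
def BidIndependent (A : Alloc k T) (ρ : Realization k T) (t : Fin T) : Prop :=
  ∀ b b' : Fin k → ℝ, PosBids b → PosBids b' → A b ρ t = A b' ρ t

/-- The probability of realization `ρ` when clicks are independent Bernoulli
with CTR vector `μ`. -/
noncomputable def prob (μ : Fin k → ℝ) (ρ : Realization k T) : ℝ :=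
  ∏ i : Fin k, ∏ t : Fin T, if ρ i t then μ i else 1 - μ i

/-- A valid CTR vector: all entries in `[0,1]`. -/
def ValidCTR (μ : Fin k → ℝ) : Prop := ∀ i, 0 ≤ μ i ∧ μ i ≤ 1

/-- A valid value profile: all values in `(0, vmax]`. -/
def ValidValues (vmax : ℝ) (v : Fin k → ℝ) : Prop := ∀ i, 0 < v i ∧ v i ≤ vmax

/-- The regret of allocation rule `A` on the instance with CTRs `μ` and values `v`
(bids equal to the true values). -/
noncomputable def regret (A : Alloc k T) (μ v : Fin k → ℝ) : ℝ :=
  (T : ℝ) * (⨆ i : Fin k, μ i * v i) -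
    ∑ ρ : Realization k T, prob μ ρ * ∑ t : Fin T, μ (A v ρ t) * v (A v ρ t)

/-- The worst-case regret `R(T; vmax)`. -/
noncomputable def worstRegret (A : Alloc k T) (vmax : ℝ) : ℝ :=
  sSup {r : ℝ | ∃ μ v : Fin k → ℝ, ValidCTR μ ∧ ValidValues vmax v ∧ r = regret A μ v}

/-- The instance `(μ, v)` has `δ`-gap: the largest product `μ_i v_i` exceeds
the second largest by `δ · max_i v_i`. -/
def HasGap (μ v : Fin k → ℝ) (δ : ℝ) : Prop :=
  ∃ i : Fin k, (∀ j, μ j * v j ≤ μ i * v i) ∧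
    μ i * v i - (⨆ j : {j : Fin k // j ≠ i}, μ j.1 * v j.1) = δ * (⨆ j : Fin k, v j)

/-- The worst-case regret over `δ`-gap instances, `R_δ(T; vmax)`. -/
noncomputable def worstGapRegret (A : Alloc k T) (vmax δ : ℝ) : ℝ :=
  sSup {r : ℝ | ∃ μ v : Fin k → ℝ,
    ValidCTR μ ∧ ValidValues vmax v ∧ HasGap μ v δ ∧ r = regret A μ v}

lemma PosBids.update {b : Fin k → ℝ} (hb : PosBids b) (i : Fin k) {x : ℝ} (hx : 0 < x) :
    PosBids (Function.update b i x) := by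
  intro j
  by_cases h : j = i
  · subst h; simpa using hx
  · simpa [h] using hb j

lemma flip_flip (ρ : Realization k T) (i : Fin k) (t : Fin T) : flip (flip ρ i t) i t = ρ := by
  funext j s
  by_cases h : j = i ∧ s = t <;> simp [flip, h]

lemma flip_apply_of_ne_agent (ρ : Realization k T) {i j : Fin k} (t s : Fin T) (h : j ≠ i) :
    flip ρ i t j s = ρ j s := by
  simp [flip, h]

/-- Bits at rounds `≥ t` do not affect the choice at rounds `≤ t`. -/
lemma alloc_flip_of_le {A : Alloc k T} (hOnline : Online A) (b : Fin k → ℝ) (ρ : Realization k T)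
    (j : Fin k) {s t : Fin T} (hst : s ≤ t) : A b (flip ρ j t) s = A b ρ s := by
  refine (hOnline b ρ (flip ρ j t) s fun r hr => ?_).symm
  have : r ≠ t := (hr.trans_le hst).ne
  simp [flip, this]

/-- Flipping a bit that is not observed has no effect on the allocation. -/
lemma alloc_flip_of_ne {A : Alloc k T} (hOnline : Online A) {b : Fin k → ℝ} {ρ : Realization k T}
    {j : Fin k} {t : Fin T} (h : A b ρ t ≠ j) (s : Fin T) : A b (flip ρ j t) s = A b ρ s := by
  refine (hOnline b ρ (flip ρ j t) s fun r _ => ?_).symm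
  by_cases hr : r = t
  · subst hr; simp [flip, h]
  · simp [flip, hr]

/-! ### Monotonicity with respect to relative bids -/

lemma winner_of_lower_other {A : Alloc k T} (hM : PointwiseMonotone A) (hIIA : IIA A)
    {b : Fin k → ℝ} {ρ : Realization k T} {t : Fin T} {j m : Fin k} {x : ℝ} (hb : PosBids b)
    (hj : A b ρ t = j) (hmj : m ≠ j) (hx : 0 < x) (hxm : x ≤ b m) :
    A (Function.update b m x) ρ t = j := by
  by_contra hne
  rcases hIIA b ρ t m x hb hx (fun h => hne (h ▸ hj)) with h | h
  · exact hmj (h.symm.trans hj)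
  · rcases hxm.lt_or_eq with hlt | heq
    · have := hM (Function.update b m x) ρ t m (b m) (hb.update m hx) h (by simpa using hlt)
      simp only [Function.update_idem, Function.update_eq_self] at this
      exact hmj (this.symm.trans hj)
    · rw [heq, Function.update_eq_self] at hne
      exact hne hj

lemma winner_of_lower_others {A : Alloc k T} (hM : PointwiseMonotone A) (hIIA : IIA A)
    {b b' : Fin k → ℝ} {ρ : Realization k T} {t : Fin T} {j : Fin k} (hb : PosBids b)
    (hb' : PosBids b') (hj : A b ρ t = j) (hjj : b' j = b j) (hle : ∀ m, b' m ≤ b m) :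
    A b' ρ t = j := by
  have key : ∀ S : Finset (Fin k), A (fun m => if m ∈ S then b' m else b m) ρ t = j := by
    intro S
    induction S using Finset.induction_on with
    | empty => simpa using hj
    | insert a S ha ih =>
      have hpos : PosBids (fun m => if m ∈ S then b' m else b m) := by
        intro m
        dsimp only
        split_ifs
        exacts [hb' m, hb m]
      have heq : (fun m => if m ∈ insert a S then b' m else b m) =
          Function.update (fun m => if m ∈ S then b' m else b m) a (b' a) := by
        funext m
        by_cases h : m = a
        · subst h; simp
        · simp [h]
      rw [heq]
      by_cases haj : a = j
      · subst haj
        rw [hjj]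
        convert ih using 2
        funext m
        by_cases h : m = a
        · subst h; simp [ha]
        · simp [h]
      · exact winner_of_lower_other hM hIIA hpos ih haj (hb' a) (by simpa [ha] using hle a)
  simpa using key univ

/-- An agent that is chosen remains so whenever her bid grows by a factor at least
as large as that of any other agent. -/
lemma winner_of_ratio_le {A : Alloc k T} (hM : PointwiseMonotone A) (hSF : ScaleFree A)
    (hIIA : IIA A) {b b' : Fin k → ℝ} {ρ : Realization k T} {t : Fin T} {j : Fin k}
    (hb : PosBids b) (hb' : PosBids b') (hj : A b ρ t = j)
    (h : ∀ m, b' m * b j ≤ b' j * b m) : A b' ρ t = j := by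
  have hc : 0 < b' j / b j := div_pos (hb' j) (hb j)
  have hscale : A (fun m => b' j / b j * b m) ρ t = j := by rw [hSF _ b ρ t hc hb, hj]
  refine winner_of_lower_others hM hIIA (fun m => mul_pos hc (hb m)) hb' hscale ?_ fun m => ?_
  · have := (hb j).ne'
    field_simp
  · rw [div_mul_eq_mul_div, le_div_iff₀ (hb j)]
    exact h m

lemma winner_update_or {A : Alloc k T} (hIIA : IIA A) {b : Fin k → ℝ} {ρ : Realization k T}
    {t : Fin T} {j m : Fin k} {x : ℝ} (hb : PosBids b) (hj : A b ρ t = j) (hmj : m ≠ j)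
    (hx : 0 < x) : A (Function.update b m x) ρ t = j ∨ A (Function.update b m x) ρ t = m := by
  by_cases h : A b ρ t = A (Function.update b m x) ρ t
  · exact Or.inl (h ▸ hj)
  · rcases hIIA b ρ t m x hb hx h with h₁ | h₁
    · exact absurd (h₁.symm.trans hj) hmj
    · exact Or.inr h₁

/-! ### Utilities of truthful mechanisms -/

/-- Two functions with (approximate) subgradients `C₁` and `C₂`, the first one larger,
have comparable increments. -/
lemma increment_le_of_subgradient_le {U₁ U₂ C₁ C₂ : ℝ → ℝ} {a b K : ℝ} (hab : a ≤ b)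
    (h₁ : ∀ x y, a ≤ x → x < y → y ≤ b → (y - x) * C₁ x ≤ U₁ y - U₁ x)
    (h₂ : ∀ x y, a ≤ x → x < y → y ≤ b → U₂ y - U₂ x ≤ (y - x) * C₂ y)
    (h₁₂ : ∀ x y, a ≤ x → x < y → y ≤ b → C₂ x ≤ C₁ y)
    (hC₁ : ∀ x, 0 ≤ C₁ x) (hC₂ : ∀ x, 0 ≤ C₂ x) (hK : ∀ x, C₂ x ≤ K) :
    U₂ b - U₂ a ≤ U₁ b - U₁ a := by
  rcases hab.eq_or_lt with rfl | hab
  · simp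
  have step : ∀ n : ℕ, 0 < n → -(2 * K * (b - a)) ≤ n * ((U₁ b - U₁ a) - (U₂ b - U₂ a)) := by
    intro n hn
    have hn' : (0 : ℝ) < n := by exact_mod_cast hn
    obtain ⟨h, hh⟩ : ∃ h, h = (b - a) / n := ⟨_, rfl⟩
    have hpos : 0 < h := hh ▸ div_pos (sub_pos.2 hab) hn'
    have hnh : n * h = b - a := by rw [hh]; field_simp
    have hx : ∀ m : ℕ, m ≤ n → a + m * h ≤ b := by
      intro m hm
      have : (m : ℝ) * h ≤ n * h := mul_le_mul_of_nonneg_right (by exact_mod_cast hm) hpos.le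
      linarith
    have ha : ∀ m : ℕ, a ≤ a + m * h := fun m => by
      have : 0 ≤ (m : ℝ) * h := by positivity
      linarith
    have key : ∀ m : ℕ, m + 1 ≤ n →
        -(h * (C₂ (a + (m + 1 : ℕ) * h) + C₂ (a + m * h))) ≤
          (U₁ (a + (m + 1 : ℕ) * h) - U₁ a) - (U₂ (a + (m + 1 : ℕ) * h) - U₂ a) := by
      intro m
      induction m with
      | zero =>
        intro hm
        have e₁ := h₁ a (a + (0 + 1 : ℕ) * h) le_rfl (by simpa using hpos) (hx _ hm)
        have e₂ := h₂ a (a + (0 + 1 : ℕ) * h) le_rfl (by simpa using hpos) (hx _ hm)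
        have e₃ := mul_nonneg hpos.le (hC₁ a)
        have e₄ := mul_nonneg hpos.le (hC₂ a)
        have e₅ : a + ((0 + 1 : ℕ) : ℝ) * h - a = h := by push_cast; ring
        have e₆ : a + ((0 : ℕ) : ℝ) * h = a := by push_cast; ring
        rw [e₅] at e₁ e₂
        rw [e₆]
        linarith
      | succ m ih =>
        intro hm
        have ih := ih (by omega)
        have hlt : ∀ p : ℕ, a + (p : ℝ) * h < a + (p + 1 : ℕ) * h := fun p => by
          push_cast; linarith
        have hd : ∀ p : ℕ, a + (p + 1 : ℕ) * h - (a + (p : ℝ) * h) = h := fun p => by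
          push_cast; ring
        have e₁ := h₁ _ _ (ha (m + 1)) (hlt _) (hx _ hm)
        have e₂ := h₂ _ _ (ha (m + 1)) (hlt _) (hx _ hm)
        have e₃ := mul_le_mul_of_nonneg_left
          (h₁₂ _ _ (ha m) (hlt _) (hx (m + 1) (by omega))) hpos.le
        rw [hd] at e₁ e₂
        linarith
    obtain ⟨m, rfl⟩ : ∃ m, n = m + 1 := ⟨n - 1, by omega⟩
    have e := key m le_rfl
    have hb : a + ((m + 1 : ℕ) : ℝ) * h = b := by linarith
    rw [hb] at e
    have e₁ : h * (C₂ b + C₂ (a + m * h)) ≤ h * (K + K) :=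
      mul_le_mul_of_nonneg_left (add_le_add (hK _) (hK _)) hpos.le
    calc -(2 * K * (b - a)) = ((m + 1 : ℕ) : ℝ) * -(h * (K + K)) := by rw [← hnh]; ring
      _ ≤ _ := mul_le_mul_of_nonneg_left (by linarith) hn'.le
  by_contra hcon
  rw [not_le, ← sub_neg] at hcon
  obtain ⟨n, hn⟩ := exists_nat_gt (2 * K * (b - a) / -((U₁ b - U₁ a) - (U₂ b - U₂ a)))
  rw [div_lt_iff₀ (by linarith)] at hn
  have hK0 : 0 ≤ 2 * K * (b - a) := by
    have := (hC₂ a).trans (hK a)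
    have := sub_pos.2 hab
    positivity
  have hn0 : 0 < n := by
    rcases Nat.eq_zero_or_pos n with rfl | h
    · simp at hn; linarith
    · exact h
  have := step n hn0
  linarith

lemma clicks_le (A : Alloc k T) (b : Fin k → ℝ) (ρ : Realization k T) (i : Fin k) :
    clicks A b ρ i ≤ T :=
  (card_le_univ _).trans (by simp)

/-- Two realizations that look the same when agent `i` bids `z` cannot have ordered
click-allocations of agent `i` on `(0, z]` with a gap on a nontrivial interval. -/
lemma not_clicks_gap {A : Alloc k T} {P : Payment k T} (hP : PaymentObservable A P)
    (hN : Normalized A P) (hT : Truthful A P) (hOnline : Online A) {b : Fin k → ℝ}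
    (hb : PosBids b) (i : Fin k) (ρ₁ ρ₂ : Realization k T) {p q z : ℝ} (hp : 0 < p) (hpq : p < q)
    (hqz : q ≤ z)
    (hobs : ∀ s, ρ₁ (A (Function.update b i z) ρ₁ s) s = ρ₂ (A (Function.update b i z) ρ₁ s) s)
    (hle : ∀ x y, 0 < x → x < y → y ≤ z →
      clicks A (Function.update b i x) ρ₂ i ≤ clicks A (Function.update b i y) ρ₁ i)
    (hlt : ∀ x y, p ≤ x → x < y → y ≤ q →
      clicks A (Function.update b i x) ρ₂ i + 1 ≤ clicks A (Function.update b i y) ρ₁ i) :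
    False := by
  obtain ⟨c, hc⟩ : ∃ c : Realization k T → ℝ → ℝ,
      c = fun ρ x => (clicks A (Function.update b i x) ρ i : ℝ) := ⟨_, rfl⟩
  obtain ⟨U, hU⟩ : ∃ U : Realization k T → ℝ → ℝ,
      U = fun ρ x => x * c ρ x - P (Function.update b i x) ρ i := ⟨_, rfl⟩
  have hc0 : ∀ ρ x, 0 ≤ c ρ x := fun ρ x => by rw [hc]; positivity
  have hcT : ∀ ρ x, c ρ x ≤ T := fun ρ x => by
    simp only [hc]; exact_mod_cast clicks_le A _ ρ i
  have hsub : ∀ ρ x y, 0 < x → 0 < y → (y - x) * c ρ x ≤ U ρ y - U ρ x := by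
    intro ρ x y hx hy
    have := hT (Function.update b i x) ρ i y (hb.update i hx) hy
    simp only [Function.update_idem] at this
    simp only [hU, hc]
    linarith
  have hU0 : ∀ ρ x, 0 < x → 0 ≤ U ρ x ∧ U ρ x ≤ x * T := by
    intro ρ x hx
    have h := hN (Function.update b i x) ρ i (hb.update i hx)
    have h' := mul_le_mul_of_nonneg_left (hcT ρ x) hx.le
    simp only [Function.update_self] at h
    simp only [hU, hc] at h' ⊢
    exact ⟨by linarith [h.2], by linarith [h.1]⟩
  have hinc : ∀ a e, 0 < a → a ≤ e → e ≤ z → U ρ₂ e - U ρ₂ a ≤ U ρ₁ e - U ρ₁ a := by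
    intro a e ha hae hez
    refine increment_le_of_subgradient_le (C₁ := c ρ₁) (C₂ := c ρ₂) (K := T) hae
      (fun x y hx hxy _ => hsub ρ₁ x y (ha.trans_le hx) (ha.trans_le (hx.trans hxy.le)))
      (fun x y hx hxy _ => ?_) (fun x y hx hxy hy => ?_) (hc0 _) (hc0 _) (hcT _)
    · have := hsub ρ₂ y x (ha.trans_le (hx.trans hxy.le)) (ha.trans_le hx)
      linarith
    · simp only [hc]
      exact_mod_cast hle x y (ha.trans_le hx) hxy (hy.trans hez)
  have hgap : (U ρ₂ q + q) - (U ρ₂ p + p) ≤ U ρ₁ q - U ρ₁ p := by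
    refine increment_le_of_subgradient_le (U₂ := fun x => U ρ₂ x + x) (C₁ := c ρ₁)
      (C₂ := fun x => c ρ₂ x + 1) (K := T + 1) hpq.le
      (fun x y hx hxy _ => hsub ρ₁ x y (hp.trans_le hx) (hp.trans_le (hx.trans hxy.le)))
      (fun x y hx hxy _ => ?_) (fun x y hx hxy hy => ?_) (hc0 _)
      (fun x => by linarith [hc0 ρ₂ x]) (fun x => by linarith [hcT ρ₂ x])
    · have := hsub ρ₂ y x (hp.trans_le (hx.trans hxy.le)) (hp.trans_le hx)
      linarith
    · simp only [hc]
      exact_mod_cast hlt x y hx hxy hy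
  have hz : U ρ₁ z = U ρ₂ z := by
    have halloc : ∀ s, A (Function.update b i z) ρ₁ s = A (Function.update b i z) ρ₂ s :=
      fun s => hOnline _ _ _ _ fun r _ => hobs r
    have hcl : clicks A (Function.update b i z) ρ₁ i = clicks A (Function.update b i z) ρ₂ i := by
      unfold clicks
      congr 1
      refine filter_congr fun s _ => ?_
      rw [← halloc s]
      refine and_congr_right fun h => ?_
      have := hobs s
      rw [h] at this
      rw [this]
    simp only [hU, hc, hcl, hP _ ρ₁ ρ₂ hobs]
  have hT1 : (0 : ℝ) < T + 1 := by positivity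
  obtain ⟨a, ha⟩ : ∃ a, a = min p ((q - p) / (T + 1)) := ⟨_, rfl⟩
  have ha0 : 0 < a := ha ▸ lt_min hp (div_pos (sub_pos.2 hpq) hT1)
  have hap : a ≤ p := ha ▸ min_le_left _ _
  have haT : a * (T + 1) ≤ q - p := by
    rw [← le_div_iff₀ hT1, ha]; exact min_le_right _ _
  have e₁ := hinc a p ha0 hap (hpq.le.trans hqz)
  have e₂ := hinc q z (hp.trans hpq) hqz le_rfl
  have e₃ := (hU0 ρ₁ a ha0).1
  have e₄ := (hU0 ρ₂ a ha0).2
  linarith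

/-- The realization that agrees with `ρ` before round `s`, has all bits equal to `1` at
round `s` and all bits equal to `0` afterwards. -/
def truncate (ρ : Realization k T) (s : Fin T) : Realization k T :=
  fun i r => if r < s then ρ i r else decide (r = s)

lemma alloc_truncate {A : Alloc k T} (hOnline : Online A) (b : Fin k → ℝ) (ρ : Realization k T)
    {r s : Fin T} (hrs : r ≤ s) : A b (truncate ρ s) r = A b ρ r := by
  refine (hOnline b ρ (truncate ρ s) r fun r' hr' => ?_).symm
  simp [truncate, hr'.trans_le hrs]

lemma flip_truncate (ρ : Realization k T) {s t : Fin T} (j : Fin k) (hts : t < s) :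
    flip (truncate ρ s) j t = truncate (flip ρ j t) s := by
  funext i r
  by_cases h : i = j ∧ r = t
  · obtain ⟨rfl, rfl⟩ := h; simp [flip, truncate, hts]
  · simp [flip, truncate, h]

lemma pointwiseMonotone_of_truthful {A : Alloc k T} {P : Payment k T}
    (hP : PaymentObservable A P) (hN : Normalized A P) (hT : Truthful A P) (hOnline : Online A)
    (hND : NonDegenerate A) : PointwiseMonotone A := by
  intro b ρ t i z hb hi hz
  by_contra hne
  have hbi := hb i
  obtain ⟨l, u, hlu, hl, hu, hI⟩ := hND b ρ t t hb le_rfl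
  rw [hi] at hl hu hI
  obtain ⟨σ, hσ⟩ : ∃ σ, σ = truncate ρ t := ⟨_, rfl⟩
  have hAσ : ∀ b', A b' σ t = A b' ρ t := fun b' => hσ ▸ alloc_truncate hOnline b' ρ le_rfl
  have hσt : σ i t = true := by simp [hσ, truncate]
  have hσ0 : ∀ r, t < r → σ i r = false := fun r hr => by
    simp [hσ, truncate, hr.not_gt, hr.ne']
  have hsub : ∀ b' s, A b' (flip σ i t) s = i ∧ flip σ i t i s = true →
      s ≠ t ∧ A b' σ s = i ∧ σ i s = true := by
    rintro b' s ⟨h₁, h₂⟩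
    have hst : s ≠ t := by
      rintro rfl
      simp [flip, hσt] at h₂
    have h₃ : σ i s = true := by simpa [flip, hst] using h₂
    have hlt : s ≤ t := by
      by_contra h
      rw [hσ0 s (not_le.1 h)] at h₃
      simp at h₃
    exact ⟨hst, by rwa [alloc_flip_of_le hOnline b' σ i hlt] at h₁, h₃⟩
  have hle : ∀ b', clicks A b' (flip σ i t) i ≤ clicks A b' σ i := fun b' =>
    card_le_card fun s hs => by
      simp only [mem_filter, mem_univ, true_and] at hs ⊢
      exact (hsub b' s hs).2
  have hlt : ∀ b', A b' ρ t = i → clicks A b' (flip σ i t) i + 1 ≤ clicks A b' σ i := by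
    intro b' h
    refine card_lt_card (ssubset_iff_of_subset ?_ |>.2 ⟨t, ?_, ?_⟩)
    · intro s hs
      simp only [mem_filter, mem_univ, true_and] at hs ⊢
      exact (hsub b' s hs).2
    · simp [hAσ, h, hσt]
    · simp [flip, hσt]
  have hmono : ∀ τ x y, 0 < x → x < y →
      clicks A (Function.update b i x) τ i ≤ clicks A (Function.update b i y) τ i := by
    intro τ x y hx hxy
    have hy := hx.trans hxy
    have h₁ := hT (Function.update b i x) τ i y (hb.update i hx) hy
    have h₂ := hT (Function.update b i y) τ i x (hb.update i hy) hx
    simp only [Function.update_idem] at h₁ h₂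
    by_contra hcon
    have hcon' : (clicks A (Function.update b i y) τ i : ℝ) <
      clicks A (Function.update b i x) τ i := by exact_mod_cast not_le.1 hcon
    nlinarith
  refine not_clicks_gap hP hN hT hOnline hb i σ (flip σ i t) (p := max l (b i / 2))
    (q := min u z) (z := z) (lt_max_of_lt_right (by linarith))
    (max_lt (lt_min hlu (by linarith)) (lt_min (by linarith) (by linarith))) (min_le_right _ _)
    (fun s => ?_) (fun x y hx hxy _ => (hmono _ x y hx hxy).trans (hle _))
    (fun x y hx hxy hy => (Nat.add_le_add_right (hmono _ x y ?_ hxy) 1).trans (hlt _ ?_))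
  · by_cases hs : s = t
    · subst hs
      rw [← hAσ] at hne
      rw [flip_apply_of_ne_agent _ _ _ hne]
    · simp [flip, hs]
  · exact (lt_max_of_lt_right (by linarith)).trans_le hx
  · have := (hI y ⟨(le_max_left _ _).trans (hx.trans hxy.le), hy.trans (min_le_left _ _)⟩ ρ
      (by simp) t (by simp))
    exact this.2 hi

/-- If agent `m` can prevent the observation of bit `(j, t)` by bidding `z`, then that bit
does not affect the bids below `z` at which `m` is chosen, up to one boundary point. -/
lemma winner_flip_of_lt {A : Alloc k T} {P : Payment k T}
    (hP : PaymentObservable A P) (hN : Normalized A P) (hT : Truthful A P) (hOnline : Online A)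
    (hM : PointwiseMonotone A) {b : Fin k → ℝ} (hb : PosBids b) {j m : Fin k} (hjm : j ≠ m)
    (t : Fin T) {z : ℝ} (s : Fin T) : ∀ ρ : Realization k T,
    A (Function.update b m z) ρ t ≠ j → ∀ x y, 0 < x → x < y → y ≤ z →
    A (Function.update b m x) ρ s = m → A (Function.update b m y) (flip ρ j t) s = m := by
  have hmono : ∀ (ρ : Realization k T) s x y, 0 < x → x ≤ y →
      A (Function.update b m x) ρ s = m → A (Function.update b m y) ρ s = m := by
    intro ρ s x y hx hxy h
    rcases hxy.eq_or_lt with rfl | hxy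
    · exact h
    · simpa using hM _ ρ s m y (hb.update m hx) h (by simpa using hxy)
  induction s using WellFoundedLT.induction with
  | ind s ih =>
    intro ρ hne x y hx hxy hyz hxm
    rcases le_or_gt s t with hst | hst
    · rw [alloc_flip_of_le hOnline _ ρ j hst]
      exact hmono ρ s x y hx hxy.le hxm
    by_contra hym
    obtain ⟨σ, hσ⟩ : ∃ σ, σ = truncate ρ s := ⟨_, rfl⟩
    have hσ' : flip σ j t = truncate (flip ρ j t) s := by rw [hσ, flip_truncate ρ j hst]
    have hAσ : ∀ b' r, r ≤ s → A b' σ r = A b' ρ r := fun b' r hr =>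
      hσ ▸ alloc_truncate hOnline b' ρ hr
    have hAσ' : ∀ b' r, r ≤ s → A b' (flip σ j t) r = A b' (flip ρ j t) r := fun b' r hr =>
      hσ' ▸ alloc_truncate hOnline b' _ hr
    have hbit : ∀ r, flip σ j t m r = σ m r := fun r => flip_apply_of_ne_agent _ _ _ hjm.symm
    have hσs : σ m s = true := by simp [hσ, truncate]
    have hσ0 : ∀ r, σ m r = true → r ≤ s := fun r hr => by
      by_contra h
      have h := not_le.1 h
      simp [hσ, truncate, h.not_gt, h.ne'] at hr
    have hneσ : A (Function.update b m z) σ t ≠ j := by rwa [hAσ _ _ hst.le]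
    have hneσ' : A (Function.update b m z) (flip σ j t) t ≠ j := by
      rwa [alloc_flip_of_le hOnline _ σ j le_rfl]
    have hsub : ∀ x' y', 0 < x' → x' < y' → y' ≤ z → ∀ r,
        A (Function.update b m x') (flip σ j t) r = m ∧ flip σ j t m r = true →
        A (Function.update b m y') σ r = m ∧ σ m r = true := by
      rintro x' y' hx' hxy' hyz' r ⟨h₁, h₂⟩
      rw [hbit] at h₂
      refine ⟨?_, h₂⟩
      rcases (hσ0 r h₂).eq_or_lt with rfl | hr
      · rw [hAσ' _ _ le_rfl] at h₁
        rw [hAσ _ _ le_rfl]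
        refine hmono ρ r x y' hx ?_ hxm
        by_contra hcon
        exact hym (hmono _ r x' y hx' (by linarith) h₁)
      · simpa [flip_flip] using ih r hr (flip σ j t) hneσ' x' y' hx' hxy' hyz' h₁
    refine not_clicks_gap hP hN hT hOnline hb m σ (flip σ j t) hx hxy hyz (fun r => ?_)
      (fun x' y' hx' hxy' hyz' => card_le_card fun r hr => ?_)
      (fun x' y' hx' hxy' hyz' => card_lt_card (ssubset_iff_of_subset (fun r hr => ?_) |>.2
        ⟨s, ?_, ?_⟩))
    · by_cases hr : r = t
      · subst hr
        rw [flip_apply_of_ne_agent _ _ _ hneσ]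
      · simp [flip, hr]
    · simp only [mem_filter, mem_univ, true_and] at hr ⊢
      exact hsub x' y' hx' hxy' hyz' r hr
    · simp only [mem_filter, mem_univ, true_and] at hr ⊢
      exact hsub x' y' (hx.trans_le hx') hxy' (hyz'.trans hyz) r hr
    · simp only [mem_filter, mem_univ, true_and]
      refine ⟨?_, hσs⟩
      rw [hAσ _ _ le_rfl]
      exact hmono ρ s x y' hx (hx'.trans hxy'.le) hxm
    · simp only [mem_filter, mem_univ, true_and, not_and]
      intro h
      rw [hAσ' _ _ le_rfl] at h
      exact absurd (hmono _ s x' y (hx.trans_le hx') (hxy'.le.trans hyz') h) hym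

lemma not_raised_past_influence {A : Alloc k T} {P : Payment k T}
    (hP : PaymentObservable A P) (hN : Normalized A P) (hT : Truthful A P) (hOnline : Online A)
    (hM : PointwiseMonotone A) (hSF : ScaleFree A) (hIIA : IIA A) {b : Fin k → ℝ}
    (hb : PosBids b) {ρ : Realization k T} {t s : Fin T} {j i m : Fin k} {c z : ℝ}
    (hc : 1 < c) (hz : 0 < z) (hij : i ≠ j) (hmj : m ≠ j) (ht : A b ρ t = j) (hs : A b ρ s = j)
    (hs' : A (Function.update b i (b i / c)) (flip ρ j t) s = i)
    (hm : A (Function.update b m z) ρ t = m) : False := by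
  have hc0 : 0 < c := one_pos.trans hc
  have hbi := hb i
  have hbm := hb m
  have hic : 0 < b i / c := div_pos hbi hc0
  have hic' : b i / c < b i := div_lt_self hbi hc
  have hmz : b m < z := by
    by_contra h
    exact hmj (hm.symm.trans (winner_of_lower_other hM hIIA hb ht hmj hz (not_lt.1 h)))
  have hmt : A (Function.update b m z) ρ t ≠ j := fun h => hmj (hm.symm.trans h)
  have hW₁ := winner_flip_of_lt hP hN hT hOnline hM hb hmj.symm t s ρ hmt
  have hback : ∀ b', PosBids b' → A (Function.update b' m z) ρ t = m → ∀ x y, 0 < x → x < y →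
      y ≤ z → A (Function.update b' m x) (flip ρ j t) s = m →
      A (Function.update b' m y) ρ s = m := by
    intro b' hb' h x y hx hxy hy h'
    have := winner_flip_of_lt hP hN hT hOnline hM hb' hmj.symm t s (flip ρ j t) (z := z)
      (by rw [alloc_flip_of_le hOnline _ ρ j le_rfl, h]; exact hmj) x y hx hxy hy h'
    rwa [flip_flip] at this
  by_cases hmi : m = i
  · subst hmi
    have := hback b hb hm (b m / c) (b m) hic hic' hmz.le hs'
    rw [Function.update_eq_self] at this
    exact hmj (this.symm.trans hs)
  obtain ⟨q, hq⟩ : ∃ q, q = Function.update b i (b i / c) := ⟨_, rfl⟩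
  have hqpos : PosBids q := hq ▸ hb.update i hic
  have hqc : ∀ x, Function.update q m x =
      Function.update (Function.update b m x) i (b i / c) := fun x => by
    rw [hq, Function.update_comm hmi]
  have hlow : ∀ (r : Fin T) x a, 0 < x → a ≠ i → A (Function.update b m x) ρ r = a →
      A (Function.update q m x) ρ r = a := by
    intro r x a hx hai h
    rw [hqc]
    exact winner_of_lower_other hM hIIA (hb.update m hx) h hai.symm hic
      (by simpa [Ne.symm hmi] using hic'.le)
  have hqz := hlow t z m hz hmi hm
  -- wherever `j` wins under `ρ`, agent `m` needs a bid larger by a factor `c` to win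
  -- under the flipped realization
  have hstep : ∀ x y, 0 < x → x ≤ z → A (Function.update b m x) ρ s = j → 0 < y → y < c * x →
      A (Function.update b m y) (flip ρ j t) s ≠ m := by
    intro x y hx hxz hjx hy hyx hmy
    obtain ⟨x', h₁, h₂⟩ := exists_between (show y / c < x by rwa [div_lt_iff₀' hc0])
    have hx' : 0 < x' := (div_pos hy hc0).trans h₁
    rw [div_lt_iff₀' hc0] at h₁
    have hne : A (Function.update q m x') (flip ρ j t) s ≠ m := fun h =>
      hmj ((hback q hqpos hqz x' x hx' h₂ hxz h).symm.trans (hlow s x j hx hij.symm hjx))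
    have hi : A (Function.update q m x') (flip ρ j t) s = i :=
      (winner_update_or hIIA hqpos (hq ▸ hs') hmi hx').resolve_right hne
    have hi' : A (Function.update b m (c * x')) (flip ρ j t) s = i := by
      refine winner_of_ratio_le hM hSF hIIA (hqpos.update m hx')
        (hb.update m (mul_pos hc0 hx')) hi fun l => ?_
      rw [hqc]
      by_cases hli : l = i
      · subst hli; simp
      by_cases hlm : l = m
      · subst hlm
        simp only [Function.update_self, Function.update_of_ne hli,
          Function.update_of_ne (Ne.symm hli)]
        apply le_of_eq
        field_simp
      · simp only [Function.update_self, Function.update_of_ne hli, Function.update_of_ne hlm,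
          Function.update_of_ne (Ne.symm hmi)]
        rw [mul_comm]
        exact mul_le_mul_of_nonneg_right hic'.le (hb l).le
    have := hM _ _ s m (c * x') (hb.update m hy) hmy (by simpa using h₁)
    rw [Function.update_idem] at this
    exact hmi (this.symm.trans hi')
  have hpow : ∀ n : ℕ, ∀ v, b m ≤ v → v < z → v < b m * c ^ n →
      A (Function.update b m v) ρ s = j := by
    have hone : ∀ x v, 0 < x → x ≤ z → A (Function.update b m x) ρ s = j → b m ≤ v → v < z →
        v < c * x → A (Function.update b m v) ρ s = j := by
      intro x v hx hxz hjx hv hvz hvx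
      obtain ⟨y, h₁, h₂⟩ := exists_between (lt_min hvz hvx)
      have hv0 := hbm.trans_le hv
      exact (winner_update_or hIIA hb hs hmj hv0).resolve_right fun h =>
        hstep x y hx hxz hjx (hv0.trans h₁) (h₂.trans_le (min_le_right _ _))
          (hW₁ v y hv0 h₁ (h₂.trans_le (min_le_left _ _)).le h)
    intro n
    induction n with
    | zero => intro v h₁ _ h₂; simp only [pow_zero, mul_one] at h₂; linarith
    | succ n ih =>
      intro v hv hvz hvn
      rcases lt_or_ge v (c * b m) with h | h
      · exact hone (b m) v hbm hmz.le (by rwa [Function.update_eq_self]) hv hvz h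
      · have h₁ : v / c < b m * c ^ n := by
          rw [div_lt_iff₀ hc0]; rw [pow_succ] at hvn; linarith
        obtain ⟨x, h₂, h₃⟩ := exists_between
          (lt_min (div_lt_self (hbm.trans_le hv) hc) h₁)
        have hmx : b m ≤ x := ((le_div_iff₀' hc0).2 h).trans h₂.le
        have hxz := (h₃.trans_le (min_le_left _ _)).trans hvz
        exact hone x v (hbm.trans_le hmx) hxz.le
          (ih x hmx hxz (h₃.trans_le (min_le_right _ _))) hv hvz ((div_lt_iff₀' hc0).1 h₂)
  obtain ⟨x, h₁, h₂⟩ := exists_between (max_lt hmz (div_lt_self hz hc))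
  have hbx : b m < x := (le_max_left _ _).trans_lt h₁
  obtain ⟨n, hn⟩ := pow_unbounded_of_one_lt (x / b m) hc
  have hjx := hpow n x hbx.le h₂ ((div_lt_iff₀' hbm).1 hn)
  have hz' := hstep x z (hbm.trans hbx) h₂.le hjx hz
    ((div_lt_iff₀' hc0).1 ((le_max_right _ _).trans_lt h₁))
  have hsb : A b (flip ρ j t) s = i := by
    have := hM _ _ s i (b i) (hb.update i hic) hs' (by simpa using hic')
    rwa [Function.update_idem, Function.update_eq_self] at this
  rw [alloc_flip_of_ne hOnline hmt] at hz'
  have h₃ := (winner_update_or hIIA hb hs hmj hz).resolve_right hz'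
  have h₄ := winner_update_or hIIA hb hsb hmi hz
  rw [alloc_flip_of_ne hOnline hmt, h₃] at h₄
  exact h₄.elim (fun h => hij h.symm) (fun h => hmj h.symm)

/-- An agent chosen at some profile is chosen at any other profile after a sufficient raise. -/
lemma exists_raise_winner {A : Alloc k T} (hM : PointwiseMonotone A) (hSF : ScaleFree A)
    (hIIA : IIA A) {b b' : Fin k → ℝ} {ρ : Realization k T} {t : Fin T} {a : Fin k}
    (hb : PosBids b) (hb' : PosBids b') (ha : A b' ρ t = a) :
    ∃ z, 0 < z ∧ A (Function.update b a z) ρ t = a := by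
  have hpos : ∀ m, 0 < b' a * b m / b' m := fun m => div_pos (mul_pos (hb' a) (hb m)) (hb' m)
  have hz : ∀ m, b' a * b m / b' m ≤ ∑ l, b' a * b l / b' l := fun m =>
    single_le_sum (f := fun l => b' a * b l / b' l) (fun l _ => (hpos l).le) (mem_univ m)
  refine ⟨∑ m, b' a * b m / b' m, (hpos a).trans_le (hz a), ?_⟩
  refine winner_of_ratio_le hM hSF hIIA hb' (hb.update a ((hpos a).trans_le (hz a))) ha fun m => ?_
  rw [Function.update_self]
  by_cases hma : m = a
  · subst hma; simp
  · rw [Function.update_of_ne hma, mul_comm]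
    exact (div_le_iff₀ (hb' m)).1 (hz m)

lemma not_influential_of_other_winner {A : Alloc k T} {P : Payment k T}
    (hP : PaymentObservable A P) (hN : Normalized A P) (hT : Truthful A P) (hOnline : Online A)
    (hND : NonDegenerate A) (hM : PointwiseMonotone A) (hSF : ScaleFree A) (hIIA : IIA A)
    {b b' : Fin k → ℝ} (hb : PosBids b) (hb' : PosBids b') {ρ : Realization k T} {t s : Fin T}
    {j : Fin k} (hts : t ≤ s) (ht : A b ρ t = j) (hs : A b ρ s = j)
    (hs' : A b (flip ρ j t) s ≠ j) : A b' ρ t = j := by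
  by_contra hne
  obtain ⟨l, u, hlu, hl, hu, hI⟩ := hND b ρ t s hb hts
  rw [ht] at hl hu hI
  have hbj := hb j
  obtain ⟨p, hp⟩ : ∃ p, p = max l (b j / 2) := ⟨_, rfl⟩
  have hp0 : 0 < p := hp ▸ lt_max_of_lt_right (by linarith)
  have hpu : p < u := hp ▸ max_lt hlu (by linarith)
  have hlp : l ≤ p := hp ▸ le_max_left _ _
  have hu0 : 0 < u := hp0.trans hpu
  have hpt : A (Function.update b j p) ρ t = j :=
    (hI p ⟨hlp, hpu.le⟩ ρ (by simp) t (by simp)).2 ht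
  have hps : A (Function.update b j p) ρ s = j :=
    (hI p ⟨hlp, hpu.le⟩ ρ (by simp) s (by simp)).2 hs
  obtain ⟨i, hi⟩ : ∃ i, A (Function.update b j u) (flip ρ j t) s = i := ⟨_, rfl⟩
  have hij : i ≠ j := fun h => hs'
    ((hI u ⟨hlu.le, le_rfl⟩ (flip ρ j t) (by simp) s (by simp)).1 (hi.trans h))
  have hc : 1 < u / p := (one_lt_div hp0).2 hpu
  have hc0 : 0 < u / p := one_pos.trans hc
  obtain ⟨b₁, hb₁⟩ : ∃ b₁, b₁ =
    Function.update (Function.update b j u) i (u / p * b i) := ⟨_, rfl⟩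
  have hb₁pos : PosBids b₁ := hb₁ ▸ (hb.update j hu0).update i (mul_pos hc0 (hb i))
  have hwin : ∀ r, A (Function.update b j p) ρ r = j → A b₁ ρ r = j := by
    intro r hr
    refine winner_of_ratio_le hM hSF hIIA (hb.update j hp0) hb₁pos hr fun m => ?_
    rw [hb₁]
    by_cases hmi : m = i
    · subst hmi
      simp only [Function.update_self, Function.update_of_ne hij, Function.update_of_ne hij.symm]
      apply le_of_eq
      field_simp
    by_cases hmj : m = j
    · subst hmj; simp
    · simp only [Function.update_self, Function.update_of_ne hmi, Function.update_of_ne hmj,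
        Function.update_of_ne hij.symm]
      rw [mul_comm]
      exact mul_le_mul_of_nonneg_right hpu.le (hb m).le
  obtain ⟨z, hz, hm⟩ := exists_raise_winner hM hSF hIIA hb₁pos hb' (rfl : A b' ρ t = _)
  refine not_raised_past_influence hP hN hT hOnline hM hSF hIIA hb₁pos hc hz hij hne
    (hwin t hpt) (hwin s hps) ?_ hm
  have : Function.update b₁ i (b₁ i / (u / p)) = Function.update b j u := by
    rw [hb₁]
    simp only [Function.update_idem, Function.update_self]
    rw [mul_div_cancel_left₀ _ hc0.ne']
    convert Function.update_eq_self i (Function.update b j u) using 2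
    rw [Function.update_of_ne hij]
  rw [this, hi]

lemma explorationSeparated_of_truthful {A : Alloc k T} {P : Payment k T}
    (hP : PaymentObservable A P) (hN : Normalized A P) (hT : Truthful A P) (hOnline : Online A)
    (hND : NonDegenerate A) (hM : PointwiseMonotone A) (hSF : ScaleFree A) (hIIA : IIA A) :
    ExplorationSeparated A := by
  rintro ρ t ⟨b, hb, s, hts, hne⟩
  obtain ⟨j, hj⟩ : ∃ j, A b ρ t = j := ⟨_, rfl⟩
  rw [hj] at hne
  suffices h : ∀ b', PosBids b' → A b' ρ t = j from fun b₁ b₂ h₁ h₂ => (h b₁ h₁).trans (h b₂ h₂).symm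
  intro b' hb'
  by_cases hs : A b ρ s = j
  · exact not_influential_of_other_winner hP hN hT hOnline hND hM hSF hIIA hb hb' hts.le hj hs
      (fun h => hne (hs.trans h.symm))
  by_cases hs' : A b (flip ρ j t) s = j
  · rw [← alloc_flip_of_le hOnline b' ρ j le_rfl]
    exact not_influential_of_other_winner hP hN hT hOnline hND hM hSF hIIA hb hb' hts.le
      ((alloc_flip_of_le hOnline b ρ j le_rfl).trans hj) hs' (by rwa [flip_flip])
  have hlow : ∀ x, 0 < x → x ≤ b j → A (Function.update b j x) ρ t = j := by
    intro x hx hxj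
    by_contra h
    apply hne
    rw [← winner_of_lower_other hM hIIA hb (rfl : A b ρ s = _) (Ne.symm hs) hx hxj,
      ← winner_of_lower_other hM hIIA hb (rfl : A b (flip ρ j t) s = _) (Ne.symm hs') hx hxj,
      alloc_flip_of_ne hOnline h]
  have hpos : ∀ m, 0 < b' m / (b' j * b m) := fun m => div_pos (hb' m) (mul_pos (hb' j) (hb m))
  obtain ⟨S, hS⟩ : ∃ S, S = ∑ m, b' m / (b' j * b m) := ⟨_, rfl⟩
  have hle : ∀ m, b' m / (b' j * b m) ≤ S := fun m =>
    hS ▸ single_le_sum (f := fun m => b' m / (b' j * b m)) (fun l _ => (hpos l).le) (mem_univ m)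
  have hS0 : 0 < S := (hpos j).trans_le (hle j)
  have hx0 : 0 < min (b j) (1 / S) := lt_min (hb j) (one_div_pos.2 hS0)
  refine winner_of_ratio_le hM hSF hIIA (hb.update j hx0) hb' (hlow _ hx0 (min_le_left _ _))
    fun m => ?_
  rw [Function.update_self]
  by_cases hmj : m = j
  · subst hmj; simp
  · rw [Function.update_of_ne hmj]
    have h₁ := (div_le_iff₀ (mul_pos (hb' j) (hb m))).1 (hle m)
    calc b' m * min (b j) (1 / S) ≤ b' m * (1 / S) :=
          mul_le_mul_of_nonneg_left (min_le_right _ _) (hb' m).le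
      _ ≤ b' j * b m := by rw [mul_one_div, div_le_iff₀ hS0]; linarith

/-! ### The payment rule -/

/-- Realizations that look the same at one bid profile lead to the same allocation at all
bid profiles. -/
lemma alloc_eq_of_observed_eq {A : Alloc k T} (hOnline : Online A) (hES : ExplorationSeparated A)
    {b b' : Fin k → ℝ} (hb : PosBids b) (hb' : PosBids b') {ρ ρ' : Realization k T}
    (h : ∀ t, ρ (A b ρ t) t = ρ' (A b ρ t) t) (s : Fin T) : A b' ρ s = A b' ρ' s := by
  have hflip : ∀ (σ : Realization k T) (a : Fin k) (t : Fin T), A b σ t ≠ a →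
      ∀ c, PosBids c → ∀ r, A c (flip σ a t) r = A c σ r := by
    intro σ a t hne c hc r
    by_cases hca : A c σ t = a
    · by_contra hr
      have hr' : t < r := by
        by_contra hle
        exact hr (alloc_flip_of_le hOnline c σ a (not_lt.1 hle))
      exact hne ((hES σ t ⟨c, hc, r, hr', hca ▸ Ne.symm hr⟩ b c hb hc).trans hca)
    · exact alloc_flip_of_ne hOnline hca r
  have key : ∀ S : Finset (Fin k × Fin T), (∀ p ∈ S, A b ρ p.2 ≠ p.1) → ∀ c, PosBids c → ∀ r,
      A c (fun a t => if (a, t) ∈ S then !(ρ a t) else ρ a t) r = A c ρ r := by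
    intro S
    induction S using Finset.induction_on with
    | empty => intro _ c _ r; simp
    | insert p S hpS ih =>
      intro hS c hc r
      have ih := ih fun q hq => hS q (mem_insert_of_mem hq)
      obtain ⟨a, t⟩ := p
      have heq : (fun a' t' => if (a', t') ∈ insert (a, t) S then !(ρ a' t') else ρ a' t') =
          flip (fun a' t' => if (a', t') ∈ S then !(ρ a' t') else ρ a' t') a t := by
        funext a' t'
        by_cases hat : a' = a ∧ t' = t
        · obtain ⟨rfl, rfl⟩ := hat
          simp [flip, hpS]
        · simp [flip, hat]
      rw [heq, hflip _ a t _ c hc r, ih c hc r]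
      rw [ih b hb t]
      exact hS (a, t) (mem_insert_self _ _)
  have := key (univ.filter fun p => ρ p.1 p.2 ≠ ρ' p.1 p.2) (fun p hp hAp => by
    simp only [mem_filter, mem_univ, true_and] at hp
    apply hp
    rw [← hAp]
    exact h p.2) b' hb' s
  rw [← this]
  congr 1
  funext a t
  cases h₁ : ρ a t <;> cases h₂ : ρ' a t <;> simp [h₁, h₂]

/-- The lowest bid with which agent `i` gets the impression at round `t`. -/
noncomputable def threshold (A : Alloc k T) (b : Fin k → ℝ) (ρ : Realization k T) (i : Fin k)
    (t : Fin T) : ℝ :=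
  sInf {x : ℝ | 0 < x ∧ A (Function.update b i x) ρ t = i}

open Classical in
/-- Each agent pays her threshold bid for every click. -/
noncomputable def thresholdPayment (A : Alloc k T) : Payment k T := fun b ρ i =>
  if PosBids b then
    ∑ t ∈ univ.filter fun t : Fin T => A b ρ t = i ∧ ρ i t = true, threshold A b ρ i t
  else 0

lemma thresholdPayment_of_pos (A : Alloc k T) {b : Fin k → ℝ} (hb : PosBids b)
    (ρ : Realization k T) (i : Fin k) : thresholdPayment A b ρ i =
      ∑ t ∈ univ.filter fun t : Fin T => A b ρ t = i ∧ ρ i t = true, threshold A b ρ i t := by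
  rw [thresholdPayment, if_pos hb]

lemma utility_thresholdPayment (A : Alloc k T) {b : Fin k → ℝ} (hb : PosBids b)
    (ρ : Realization k T) (i : Fin k) (v : ℝ) :
    v * (clicks A b ρ i : ℝ) - thresholdPayment A b ρ i =
      ∑ t ∈ univ.filter (fun t : Fin T => A b ρ t = i ∧ ρ i t = true),
        (v - threshold A b ρ i t) := by
  rw [thresholdPayment_of_pos A hb, sum_sub_distrib, sum_const, nsmul_eq_mul, clicks, mul_comm]

lemma threshold_nonneg (A : Alloc k T) (b : Fin k → ℝ) (ρ : Realization k T) (i : Fin k)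
    (t : Fin T) : 0 ≤ threshold A b ρ i t :=
  Real.sInf_nonneg fun _ hx => hx.1.le

lemma threshold_le (A : Alloc k T) {b : Fin k → ℝ} {ρ : Realization k T} {i : Fin k}
    {t : Fin T} {x : ℝ} (hx : 0 < x) (h : A (Function.update b i x) ρ t = i) :
    threshold A b ρ i t ≤ x :=
  csInf_le ⟨0, fun _ hy => hy.1.le⟩ ⟨hx, h⟩

lemma le_threshold {A : Alloc k T} (hM : PointwiseMonotone A) {b : Fin k → ℝ} (hb : PosBids b)
    {ρ : Realization k T} {i : Fin k} {t : Fin T} {v : ℝ} (h : A b ρ t = i)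
    (hv : A (Function.update b i v) ρ t ≠ i) : v ≤ threshold A b ρ i t := by
  refine le_csInf ⟨b i, hb i, by rwa [Function.update_eq_self]⟩ fun y hy => ?_
  by_contra hlt
  apply hv
  have := hM (Function.update b i y) ρ t i v (hb.update i hy.1) hy.2
    (by simpa using not_le.1 hlt)
  rwa [Function.update_idem] at this

lemma threshold_update (A : Alloc k T) (b : Fin k → ℝ) (ρ : Realization k T) (i : Fin k)
    (t : Fin T) (v : ℝ) : threshold A (Function.update b i v) ρ i t = threshold A b ρ i t := by
  simp only [threshold, Function.update_idem]

lemma paymentObservable_thresholdPayment {A : Alloc k T} (hOnline : Online A)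
    (hES : ExplorationSeparated A) : PaymentObservable A (thresholdPayment A) := by
  intro b ρ ρ' h
  funext i
  by_cases hb : PosBids b
  · have hA := fun c (hc : PosBids c) s => alloc_eq_of_observed_eq hOnline hES hb hc h s
    rw [thresholdPayment_of_pos A hb, thresholdPayment_of_pos A hb]
    refine sum_congr (filter_congr fun t _ => ?_) fun t _ => ?_
    · rw [← hA b hb t]
      refine and_congr_right fun hi => ?_
      have := h t
      rw [hi] at this
      rw [this]
    · unfold threshold
      congr 1
      ext x
      refine and_congr_right fun hx => ?_
      rw [hA _ (hb.update i hx) t]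
  · simp [thresholdPayment, hb]

lemma normalized_thresholdPayment (A : Alloc k T) : Normalized A (thresholdPayment A) := by
  intro b ρ i hb
  refine ⟨?_, sub_nonneg.1 ?_⟩
  · rw [thresholdPayment_of_pos A hb]
    exact sum_nonneg fun t _ => threshold_nonneg A b ρ i t
  · rw [utility_thresholdPayment A hb]
    refine sum_nonneg fun t ht => sub_nonneg.2 (threshold_le A (hb i) ?_)
    rw [Function.update_eq_self]
    exact (mem_filter.1 ht).2.1

lemma truthful_thresholdPayment {A : Alloc k T} (hM : PointwiseMonotone A) :
    Truthful A (thresholdPayment A) := by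
  intro b ρ i v hb hv
  rw [utility_thresholdPayment A hb, utility_thresholdPayment A (hb.update i hv), ge_iff_le,
    sum_filter, sum_filter]
  refine sum_le_sum fun t _ => ?_
  rw [threshold_update]
  by_cases hbit : ρ i t = true
  · by_cases h₁ : A b ρ t = i <;> by_cases h₂ : A (Function.update b i v) ρ t = i
    · simp [h₁, h₂, hbit]
    · simpa [h₁, h₂, hbit] using le_threshold hM hb h₁ h₂
    · simpa [h₁, h₂, hbit] using threshold_le A hv h₂
    · simp [h₁, h₂]
  · simp [hbit]

/-- For a non-degenerate, scale-free, IIA deterministic allocation rule `A`,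
there is a payment rule `P` making `(A,P)` normalized and truthful iff `A` is
pointwise monotone and exploration-separated. -/
theorem truthful_characterization (k T : ℕ) (A : Alloc k T)
    (hOnline : Online A) (hND : NonDegenerate A) (hSF : ScaleFree A) (hIIA : IIA A) :
    (∃ P : Payment k T, PaymentObservable A P ∧ Normalized A P ∧ Truthful A P) ↔
      (PointwiseMonotone A ∧ ExplorationSeparated A) := by
  constructor
  · rintro ⟨P, hP, hN, hT⟩
    have hM := pointwiseMonotone_of_truthful hP hN hT hOnline hND
    exact ⟨hM, explorationSeparated_of_truthful hP hN hT hOnline hND hM hSF hIIA⟩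
  · rintro ⟨hM, hES⟩
    exact ⟨thresholdPayment A, paymentObservable_thresholdPayment hOnline hES,
      normalized_thresholdPayment A, truthful_thresholdPayment hM⟩

end MAB
end

section
/- Fix a number of agents k ≥ 2 and v_max > 0, and let (A_T)_{T ≥ 1} be a family of exploration-separated deterministic allocation rules, where A_T has time horizon T. Suppose there exist constants C and γ < 1 such that the worst-case regret of A_T satisfies R(T; v_max) ≤ C · v_max · T^γ for all T. Then for every fixed δ ∈ (0, 1/4] and every λ < 2(1 − γ) there exists a constant c > 0 such that the worst-case δ-gap regret of A_T satisfies R_δ(T; v_max) ≥ c · δ · v_max · T^λ for all sufficiently large T. -/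
open Finset

namespace MAB

variable {k T : ℕ}

section Flip

lemma flip_self (ρ : Realization k T) (j : Fin k) (t : Fin T) : flip ρ j t j t = !(ρ j t) := by
  simp [flip]

lemma flip_of_ne (ρ : Realization k T) (i j : Fin k) {s t : Fin T} (h : s ≠ t) :
    flip ρ j t i s = ρ i s := by
  simp [flip, h]

lemma flip_involutive (j : Fin k) (t : Fin T) :
    Function.Involutive fun ρ : Realization k T => flip ρ j t := by
  intro ρ
  funext i s
  by_cases h : i = j ∧ s = t <;> simp [flip, h]

lemma sum_comp_flip (j : Fin k) (t : Fin T) (f : Realization k T → ℝ) :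
    ∑ ρ, f (flip ρ j t) = ∑ ρ, f ρ :=
  Equiv.sum_comp (flip_involutive j t).toPerm f

lemma sum_eq_zero_of_flip_neg (j : Fin k) (t : Fin T) (f : Realization k T → ℝ)
    (h : ∀ ρ, f (flip ρ j t) = -f ρ) : ∑ ρ, f ρ = 0 := by
  have h1 := sum_comp_flip j t f
  simp only [h, sum_neg_distrib] at h1
  linarith

end Flip

section Influence

/-- Round `t` is influential for some realization that agrees with `ρ` before round `t`. -/
def MayInfluence (A : Alloc k T) (ρ : Realization k T) (t : Fin T) : Prop :=
  ∃ ρ' : Realization k T, (∀ i s, s < t → ρ' i s = ρ i s) ∧ Influential A ρ' t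

lemma Online.congr {A : Alloc k T} (hA : Online A) (b : Fin k → ℝ) {ρ ρ' : Realization k T}
    {t : Fin T} (h : ∀ i s, s < t → ρ' i s = ρ i s) : A b ρ' t = A b ρ t :=
  hA b ρ' ρ t fun s hs => h _ s hs

lemma MayInfluence.congr {A : Alloc k T} {ρ ρ' : Realization k T} {t : Fin T}
    (h : ∀ i s, s < t → ρ' i s = ρ i s) : MayInfluence A ρ' t ↔ MayInfluence A ρ t := by
  constructor
  · rintro ⟨σ, hσ, hI⟩
    exact ⟨σ, fun i s hs => (hσ i s hs).trans (h i s hs), hI⟩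
  · rintro ⟨σ, hσ, hI⟩
    exact ⟨σ, fun i s hs => (hσ i s hs).trans (h i s hs).symm, hI⟩

lemma MayInfluence.bid_independent {A : Alloc k T} (hA : Online A) (hE : ExplorationSeparated A)
    {ρ : Realization k T} {t : Fin T} (h : MayInfluence A ρ t) {b b' : Fin k → ℝ}
    (hb : PosBids b) (hb' : PosBids b') : A b ρ t = A b' ρ t := by
  obtain ⟨σ, hσ, hI⟩ := h
  rw [← hA.congr b hσ, ← hA.congr b' hσ]
  exact hE σ t hI b b' hb hb'

lemma alloc_flip_eq {A : Alloc k T} (hA : Online A) {b : Fin k → ℝ} (hb : PosBids b)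
    {ρ : Realization k T} {t : Fin T} {j : Fin k}
    (h : ¬(MayInfluence A ρ t ∧ A b ρ t = j)) (s : Fin T) : A b (flip ρ j t) s = A b ρ s := by
  by_cases hj : A b ρ t = j
  · rcases le_or_gt s t with hst | hst
    · exact hA.congr b fun i u hu => flip_of_ne ρ i j (hu.trans_le hst).ne
    · by_contra hne
      refine h ⟨⟨ρ, fun _ _ _ => rfl, b, hb, s, hst, ?_⟩, hj⟩
      rw [hj]
      exact fun he => hne he.symm
  · refine (hA b ρ _ s fun u _ => ?_).symm
    have : ¬(A b ρ u = j ∧ u = t) := by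
      rintro ⟨h1, rfl⟩
      exact hj h1
    simp [flip, this]

end Influence

section Tilt

/-- Likelihood ratio, at an observed bit, of a Bernoulli variable of parameter `1/2 + ε`
against the uniform bit. -/
noncomputable def tilt (ε : ℝ) (x : Bool) : ℝ := if x then 1 + 2 * ε else 1 - 2 * ε

open Classical in
/-- The factor `tilt` restricted to the rounds where `ξ` holds. -/
noncomputable def tiltOn (ε : ℝ) (ξ : Fin T → Realization k T → Prop) (j : Fin k)
    (ρ : Realization k T) (t : Fin T) : ℝ := if ξ t ρ then tilt ε (ρ j t) else 1

lemma tilt_pos {ε : ℝ} (h0 : 0 ≤ ε) (h1 : ε ≤ 1 / 4) (x : Bool) : 0 < tilt ε x := by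
  cases x <;> simp [tilt] <;> linarith

/-- The event `ξ t` depends only on the bits of the rounds before `t`. -/
def Predictable (ξ : Fin T → Realization k T → Prop) : Prop :=
  ∀ (t : Fin T) (ρ ρ' : Realization k T), (∀ i s, s < t → ρ' i s = ρ i s) → (ξ t ρ' ↔ ξ t ρ)

lemma Predictable.flip_iff {ξ : Fin T → Realization k T → Prop} (hξ : Predictable ξ)
    (ρ : Realization k T) (j : Fin k) {s t : Fin T} (hst : s ≤ t) :
    ξ s (flip ρ j t) ↔ ξ s ρ :=
  hξ s ρ _ fun i _ hu => flip_of_ne ρ i j (hu.trans_le hst).ne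

lemma sum_prod_tilt_eq (ε : ℝ) {ξ : Fin T → Realization k T → Prop} (hξ : Predictable ξ)
    (j : Fin k) (g : Realization k T → ℝ) (hg : ∀ t ρ, ¬ξ t ρ → g (flip ρ j t) = g ρ) :
    ∑ ρ, (∏ t, tiltOn ε ξ j ρ t) * g ρ = ∑ ρ : Realization k T, (∏ t, tilt ε (ρ j t)) * g ρ := by
  have key : ∀ m, m ≤ T →
      ∑ ρ, (∏ t : Fin T, if (t : ℕ) < m then tiltOn ε ξ j ρ t else tilt ε (ρ j t)) * g ρ =
        ∑ ρ : Realization k T, (∏ t, tilt ε (ρ j t)) * g ρ := by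
    intro m
    induction m with
    | zero => simp
    | succ m ih =>
      intro hm
      rw [← ih (by omega), ← sub_eq_zero, ← sum_sub_distrib]
      set u : Fin T := ⟨m, by omega⟩ with hu
      have hsplit : ∀ ρ : Realization k T,
          (∏ t : Fin T, if (t : ℕ) < m + 1 then tiltOn ε ξ j ρ t else tilt ε (ρ j t)) * g ρ -
            (∏ t : Fin T, if (t : ℕ) < m then tiltOn ε ξ j ρ t else tilt ε (ρ j t)) * g ρ =
          (tiltOn ε ξ j ρ u - tilt ε (ρ j u)) *
            (∏ t ∈ univ.erase u, if t < u then tiltOn ε ξ j ρ t else tilt ε (ρ j t)) * g ρ := by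
        intro ρ
        rw [← mul_prod_erase univ _ (mem_univ u), ← mul_prod_erase univ
          (fun t : Fin T => if (t : ℕ) < m then tiltOn ε ξ j ρ t else tilt ε (ρ j t)) (mem_univ u)]
        have h1 : (∏ t ∈ univ.erase u,
            if (t : ℕ) < m + 1 then tiltOn ε ξ j ρ t else tilt ε (ρ j t)) =
            ∏ t ∈ univ.erase u, if t < u then tiltOn ε ξ j ρ t else tilt ε (ρ j t) := by
          refine prod_congr rfl fun t ht => ?_
          have hne : (t : ℕ) ≠ m := fun h => (mem_erase.1 ht).1 (Fin.ext h)
          have hiff : ((t : ℕ) < m + 1) ↔ t < u := by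
            rw [Fin.lt_def]
            simp only [hu]
            omega
          simp only [hiff]
        have h2 : (∏ t ∈ univ.erase u,
            if (t : ℕ) < m then tiltOn ε ξ j ρ t else tilt ε (ρ j t)) =
            ∏ t ∈ univ.erase u, if t < u then tiltOn ε ξ j ρ t else tilt ε (ρ j t) := rfl
        rw [h1, h2]
        simp only [hu, Nat.lt_succ_self, lt_irrefl, if_true, if_false]
        ring
      rw [sum_congr rfl fun ρ _ => hsplit ρ]
      refine sum_eq_zero_of_flip_neg j u _ fun ρ => ?_
      have hR : (∏ t ∈ univ.erase u, if t < u then tiltOn ε ξ j (flip ρ j u) t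
            else tilt ε (flip ρ j u j t)) =
          ∏ t ∈ univ.erase u, if t < u then tiltOn ε ξ j ρ t else tilt ε (ρ j t) := by
        refine prod_congr rfl fun t ht => ?_
        rw [flip_of_ne ρ j j (mem_erase.1 ht).1]
        by_cases htu : t < u
        · have := hξ.flip_iff ρ j htu.le
          by_cases hx : ξ t ρ <;> simp [htu, tiltOn, this, hx, flip_of_ne ρ j j htu.ne]
        · simp only [htu, if_false]
      rw [hR]
      by_cases hx : ξ u ρ
      · simp [tiltOn, hξ.flip_iff ρ j le_rfl, hx]
      · rw [hg u ρ hx]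
        have : tiltOn ε ξ j (flip ρ j u) u - tilt ε (flip ρ j u j u) =
            -(tiltOn ε ξ j ρ u - tilt ε (ρ j u)) := by
          simp only [tiltOn, hξ.flip_iff ρ j le_rfl, hx, if_false, flip_self]
          cases ρ j u <;> simp [tilt]
        rw [this]
        ring
  have := key T le_rfl
  simpa using this

/-- The probability of each realization under CTR vector `(1/2, …, 1/2)`. -/
noncomputable def unifWeight (k T : ℕ) : ℝ := ((1 / 2) ^ T) ^ k

/-- All CTRs are `1/2` except that of agent `j`, which is `1/2 + ε`. -/
noncomputable def biasedCTR (j : Fin k) (ε : ℝ) : Fin k → ℝ :=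
  fun i => if i = j then 1 / 2 + ε else 1 / 2

lemma unifWeight_pos : 0 < unifWeight k T := by
  unfold unifWeight
  positivity

lemma unifWeight_mul_card : unifWeight k T * Fintype.card (Realization k T) = 1 := by
  simp only [unifWeight, Realization, Fintype.card_pi, prod_const, card_univ, Fintype.card_fin,
    Fintype.card_bool]
  push_cast
  rw [← mul_pow, ← mul_pow]
  norm_num

lemma prob_biasedCTR (j : Fin k) (ε : ℝ) (ρ : Realization k T) :
    prob (biasedCTR j ε) ρ = unifWeight k T * ∏ t, tilt ε (ρ j t) := by
  have h : ∀ i t, (if ρ i t then biasedCTR j ε i else 1 - biasedCTR j ε i) =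
      1 / 2 * (if i = j then tilt ε (ρ i t) else 1) := by
    intro i t
    by_cases hi : i = j <;> cases ρ i t <;> simp [biasedCTR, tilt, hi] <;> ring
  simp only [prob, h, prod_mul_distrib, prod_const, card_univ, Fintype.card_fin, unifWeight]
  congr 1
  rw [prod_eq_single j (fun i _ hi => by simp [hi]) (by simp)]
  simp

lemma sum_prod_tilt (ε : ℝ) (j : Fin k) :
    ∑ ρ : Realization k T, ∏ t, tilt ε (ρ j t) = Fintype.card (Realization k T) := by
  have h := sum_prod_tilt_eq (k := k) (T := T) ε (ξ := fun _ _ => False)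
    (fun _ _ _ _ => Iff.rfl) j (fun _ => 1) (fun _ _ _ => rfl)
  simpa [tiltOn] using h.symm

lemma sum_prob_biasedCTR (j : Fin k) (ε : ℝ) :
    ∑ ρ : Realization k T, prob (biasedCTR j ε) ρ = 1 := by
  simp only [prob_biasedCTR, ← mul_sum, sum_prod_tilt, unifWeight_mul_card]

open Classical in
lemma sum_neg_log_tiltOn_le {ε : ℝ} (h0 : 0 ≤ ε) (h1 : ε ≤ 1 / 4)
    {ξ : Fin T → Realization k T → Prop} (hξ : Predictable ξ) (j : Fin k) (t : Fin T) :
    ∑ ρ, -Real.log (tiltOn ε ξ j ρ t) ≤ 4 * ε ^ 2 * ∑ ρ, if ξ t ρ then (1 : ℝ) else 0 := by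
  have hlog : -Real.log (1 + 2 * ε) - Real.log (1 - 2 * ε) ≤ 8 * ε ^ 2 := by
    have hx : (0 : ℝ) < 1 - 4 * ε ^ 2 := by nlinarith
    have := Real.one_sub_inv_le_log_of_pos hx
    have hm : Real.log (1 - 4 * ε ^ 2) = Real.log (1 + 2 * ε) + Real.log (1 - 2 * ε) := by
      rw [← Real.log_mul (by linarith) (by linarith)]
      ring_nf
    have hinv : (1 - 4 * ε ^ 2)⁻¹ ≤ 1 + 8 * ε ^ 2 := by
      rw [inv_le_iff_one_le_mul₀ hx]
      nlinarith [mul_nonneg h0 h0, mul_nonneg (mul_nonneg h0 h0) (sub_nonneg.2 h1)]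
    linarith
  have hpair : ∀ ρ, -Real.log (tiltOn ε ξ j ρ t) + -Real.log (tiltOn ε ξ j (flip ρ j t) t) ≤
      8 * ε ^ 2 * if ξ t ρ then (1 : ℝ) else 0 := by
    intro ρ
    have hf := hξ.flip_iff ρ j (le_refl t)
    by_cases hx : ξ t ρ
    · simp only [tiltOn, hf, hx, if_true, flip_self]
      cases ρ j t <;> simp [tilt] <;> linarith
    · simp [tiltOn, hf, hx]
  have hs := sum_le_sum fun ρ (_ : ρ ∈ univ) => hpair ρ
  rw [sum_add_distrib, sum_comp_flip j t fun ρ => -Real.log (tiltOn ε ξ j ρ t), ← mul_sum] at hs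
  linarith

lemma one_sub_le_of_pos {x : ℝ} (hx : 0 < x) : 1 - x ≤ 1 / 8 + 8 * (x - 1 - Real.log x) := by
  have hy := Real.sqrt_pos.2 hx
  have hxy := Real.sq_sqrt hx.le
  have hl : Real.log x = 2 * Real.log √x := by rw [Real.log_sqrt hx.le]; ring
  have := Real.log_le_sub_one_of_pos hy
  nlinarith [sq_nonneg (8 * (1 - √x) - 1)]

open Classical in
lemma change_of_measure {ε : ℝ} (h0 : 0 ≤ ε) (h1 : ε ≤ 1 / 4)
    {ξ : Fin T → Realization k T → Prop} (hξ : Predictable ξ) (j : Fin k)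
    {h : Realization k T → ℝ} {H : ℝ} (hh0 : ∀ ρ, 0 ≤ h ρ) (hhH : ∀ ρ, h ρ ≤ H)
    (hg : ∀ t ρ, ¬ξ t ρ → h (flip ρ j t) = h ρ) :
    unifWeight k T * ∑ ρ, h ρ - ∑ ρ, prob (biasedCTR j ε) ρ * h ρ ≤
      H * (1 / 8 + 32 * ε ^ 2 *
        (unifWeight k T * ∑ ρ, ∑ t, if ξ t ρ then (1 : ℝ) else 0)) := by
  set L : Realization k T → ℝ := fun ρ => ∏ t, tiltOn ε ξ j ρ t with hL
  have hfac : ∀ ρ t, 0 < tiltOn ε ξ j ρ t := by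
    intro ρ t
    unfold tiltOn
    split_ifs
    · exact tilt_pos h0 h1 _
    · exact one_pos
  have hLpos : ∀ ρ, 0 < L ρ := fun ρ => prod_pos fun t _ => hfac ρ t
  have hH : 0 ≤ H := (hh0 fun _ _ => true).trans (hhH _)
  have hLh : ∑ ρ, prob (biasedCTR j ε) ρ * h ρ = unifWeight k T * ∑ ρ, L ρ * h ρ := by
    rw [hL, sum_prod_tilt_eq ε hξ j h hg]
    simp only [prob_biasedCTR, mul_sum, mul_assoc]
  have hL1 : ∑ ρ, L ρ = Fintype.card (Realization k T) := by
    have := sum_prod_tilt_eq ε hξ j (fun _ => 1) (fun _ _ _ => rfl)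
    simp only [mul_one] at this
    rw [hL, this, sum_prod_tilt]
  have hlog : ∑ ρ, -Real.log (L ρ) ≤ 4 * ε ^ 2 * ∑ ρ, ∑ t, if ξ t ρ then (1 : ℝ) else 0 := by
    have hprod : ∀ ρ, -Real.log (L ρ) = ∑ t, -Real.log (tiltOn ε ξ j ρ t) := fun ρ => by
      rw [hL, sum_neg_distrib, Real.log_prod fun t _ => (hfac ρ t).ne']
    rw [sum_congr rfl fun ρ _ => hprod ρ, sum_comm,
      sum_comm (f := fun ρ t => if ξ t ρ then (1 : ℝ) else 0), mul_sum]
    exact sum_le_sum fun t _ => sum_neg_log_tiltOn_le h0 h1 hξ j t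
  have hpt : ∀ ρ, h ρ - L ρ * h ρ ≤ H * (1 / 8 + 8 * (L ρ - 1 - Real.log (L ρ))) := by
    intro ρ
    have h2 := one_sub_le_of_pos (hLpos ρ)
    have h3 := Real.log_le_sub_one_of_pos (hLpos ρ)
    nlinarith [mul_le_mul_of_nonneg_left h2 (hh0 ρ), hhH ρ, hh0 ρ]
  have hsum := sum_le_sum fun ρ (_ : ρ ∈ univ) => hpt ρ
  have hr : ∑ ρ, H * (1 / 8 + 8 * (L ρ - 1 - Real.log (L ρ))) =
      H * (Fintype.card (Realization k T) * (1 / 8) + 8 * ∑ ρ, -Real.log (L ρ)) := by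
    rw [← mul_sum]
    simp only [sum_add_distrib, ← mul_sum, sum_sub_distrib, hL1, sum_neg_distrib, sum_const,
      card_univ, nsmul_eq_mul]
    ring
  rw [sum_sub_distrib, hr] at hsum
  rw [hLh, ← mul_sub]
  calc _ ≤ unifWeight k T * (H * (Fintype.card (Realization k T) * (1 / 8) +
        8 * (4 * ε ^ 2 * ∑ ρ, ∑ t, if ξ t ρ then (1 : ℝ) else 0))) := by
        refine mul_le_mul_of_nonneg_left (hsum.trans ?_) unifWeight_pos.le
        gcongr
    _ = H * (unifWeight k T * Fintype.card (Realization k T) * (1 / 8) + 32 * ε ^ 2 *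
        (unifWeight k T * ∑ ρ, ∑ t, if ξ t ρ then (1 : ℝ) else 0)) := by ring
    _ = _ := by rw [unifWeight_mul_card, one_mul]

end Tilt

section Regret

lemma prob_nonneg {μ : Fin k → ℝ} (hμ : ValidCTR μ) (ρ : Realization k T) : 0 ≤ prob μ ρ := by
  refine prod_nonneg fun i _ => prod_nonneg fun t _ => ?_
  split_ifs
  · exact (hμ i).1
  · linarith [(hμ i).2]

lemma regret_le [NeZero k] (A : Alloc k T) {vmax : ℝ} {μ v : Fin k → ℝ} (hμ : ValidCTR μ)
    (hv : ValidValues vmax v) : regret A μ v ≤ T * vmax := by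
  have hsup : (⨆ i, μ i * v i) ≤ vmax := ciSup_le fun i =>
    (mul_le_of_le_one_left (hv i).1.le (hμ i).2).trans (hv i).2
  have hrew : 0 ≤ ∑ ρ : Realization k T, prob μ ρ * ∑ t : Fin T, μ (A v ρ t) * v (A v ρ t) :=
    sum_nonneg fun ρ _ => mul_nonneg (prob_nonneg hμ ρ)
      (sum_nonneg fun t _ => mul_nonneg (hμ _).1 (hv _).1.le)
  have := mul_le_mul_of_nonneg_left hsup (Nat.cast_nonneg (α := ℝ) T)
  unfold regret
  linarith

lemma regret_le_worstRegret [NeZero k] (A : Alloc k T) {vmax : ℝ} {μ v : Fin k → ℝ}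
    (hμ : ValidCTR μ) (hv : ValidValues vmax v) : regret A μ v ≤ worstRegret A vmax := by
  refine le_csSup ⟨T * vmax, ?_⟩ ⟨μ, v, hμ, hv, rfl⟩
  rintro r ⟨μ', v', hμ', hv', rfl⟩
  exact regret_le A hμ' hv'

lemma regret_le_worstGapRegret [NeZero k] (A : Alloc k T) {vmax δ : ℝ} {μ v : Fin k → ℝ}
    (hμ : ValidCTR μ) (hv : ValidValues vmax v) (hgap : HasGap μ v δ) :
    regret A μ v ≤ worstGapRegret A vmax δ := by
  refine le_csSup ⟨T * vmax, ?_⟩ ⟨μ, v, hμ, hv, hgap, rfl⟩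
  rintro r ⟨μ', v', hμ', hv', -, rfl⟩
  exact regret_le A hμ' hv'

lemma sum_prob_mul_gap_le_regret (A : Alloc k T) {μ : Fin k → ℝ} (v : Fin k → ℝ)
    (hμ : ∑ ρ : Realization k T, prob μ ρ = 1) (i : Fin k) :
    ∑ ρ : Realization k T, prob μ ρ * ∑ t, (μ i * v i - μ (A v ρ t) * v (A v ρ t)) ≤
      regret A μ v := by
  have hle : μ i * v i ≤ ⨆ i, μ i * v i :=
    le_ciSup (f := fun i => μ i * v i) (Set.finite_range _).bddAbove i
  have := mul_le_mul_of_nonneg_left hle (Nat.cast_nonneg (α := ℝ) T)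
  simp only [sum_sub_distrib, sum_const, card_univ, Fintype.card_fin, nsmul_eq_mul, mul_sub,
    ← sum_mul, hμ, one_mul]
  unfold regret
  linarith

lemma validCTR_biasedCTR (j : Fin k) {ε : ℝ} (h0 : 0 ≤ ε) (h1 : ε ≤ 1 / 4) :
    ValidCTR (biasedCTR j ε) := by
  intro i
  unfold biasedCTR
  split_ifs <;> constructor <;> linarith

/-- Agent `i` has value `vmax` and every other agent has value `(1 - 2δ) vmax`. -/
noncomputable def favoring (vmax δ : ℝ) (i : Fin k) : Fin k → ℝ :=
  fun j => if j = i then vmax else (1 - 2 * δ) * vmax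

lemma validValues_favoring {vmax δ : ℝ} (hv : 0 < vmax) (h0 : 0 ≤ δ) (h1 : δ ≤ 1 / 4)
    (i : Fin k) : ValidValues vmax (favoring vmax δ i) := by
  intro j
  unfold favoring
  split_ifs <;> constructor <;> nlinarith

lemma hasGap_favoring {vmax δ : ℝ} (hv : 0 < vmax) (h0 : 0 ≤ δ) {i j : Fin k} (hij : i ≠ j) :
    HasGap (biasedCTR j 0) (favoring vmax δ i) δ := by
  have hμ : ∀ l, biasedCTR j 0 l = 1 / 2 := by simp [biasedCTR]
  have hle : ∀ l, favoring vmax δ i l ≤ vmax := by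
    intro l
    unfold favoring
    split_ifs <;> nlinarith
  have hi : favoring vmax δ i i = vmax := by simp [favoring]
  refine ⟨i, fun l => ?_, ?_⟩
  · rw [hμ, hμ, hi]
    linarith [hle l]
  · have : Nonempty {l : Fin k // l ≠ i} := ⟨⟨j, hij.symm⟩⟩
    have : Nonempty (Fin k) := ⟨i⟩
    have h2 : (⨆ l : {l : Fin k // l ≠ i}, biasedCTR j 0 l.1 * favoring vmax δ i l.1) =
        1 / 2 * ((1 - 2 * δ) * vmax) := by
      rw [← ciSup_const (ι := {l : Fin k // l ≠ i}) (a := 1 / 2 * ((1 - 2 * δ) * vmax))]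
      exact iSup_congr fun l => by rw [hμ, favoring, if_neg l.2]
    have h3 : (⨆ l, favoring vmax δ i l) = vmax :=
      le_antisymm (ciSup_le hle) (hi.symm.le.trans (le_ciSup (Set.finite_range _).bddAbove i))
    rw [h2, h3, hμ, hi]
    ring

/-- Under the uniform measure, some agent among any two is skipped in at least half of the
rounds on average. -/
lemma exists_ne_skipped (A : Alloc k T) (v : Fin k → ℝ) {a b : Fin k} (hab : a ≠ b) :
    ∃ i j : Fin k, i ≠ j ∧
      (T : ℝ) / 2 ≤ unifWeight k T * ∑ ρ, ∑ t, if A v ρ t = j then (0 : ℝ) else 1 := by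
  have hsum : (T : ℝ) ≤ unifWeight k T * (∑ ρ, ∑ t, if A v ρ t = a then (0 : ℝ) else 1) +
      unifWeight k T * ∑ ρ, ∑ t, if A v ρ t = b then (0 : ℝ) else 1 := by
    rw [← mul_add, ← sum_add_distrib]
    have h1 : ∀ ρ : Realization k T, (T : ℝ) ≤ (∑ t, if A v ρ t = a then (0 : ℝ) else 1) +
        ∑ t, if A v ρ t = b then (0 : ℝ) else 1 := by
      intro ρ
      rw [← sum_add_distrib]
      calc (T : ℝ) = ∑ _t : Fin T, (1 : ℝ) := by simp
        _ ≤ _ := sum_le_sum fun t _ => by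
          by_cases ha : A v ρ t = a
          · simp [ha, hab]
          · rw [if_neg ha]
            split_ifs <;> norm_num
    calc (T : ℝ) = unifWeight k T * Fintype.card (Realization k T) * T := by
          rw [unifWeight_mul_card, one_mul]
      _ = unifWeight k T * ∑ _ρ : Realization k T, (T : ℝ) := by
          rw [sum_const, card_univ, nsmul_eq_mul, mul_assoc]
      _ ≤ _ := mul_le_mul_of_nonneg_left (sum_le_sum fun ρ _ => h1 ρ) unifWeight_pos.le
  rcases le_total ((T : ℝ) / 2)
    (unifWeight k T * ∑ ρ, ∑ t, if A v ρ t = a then (0 : ℝ) else 1) with h | h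
  · exact ⟨b, a, hab.symm, h⟩
  · exact ⟨a, b, hab, by linarith⟩

open Classical in
/-- Trade-off between the gap regret, which pays for `N` expected exploration rounds, and the
worst-case regret, which is large unless `N` is of order at least `ε⁻²`. -/
lemma exploration_tradeoff (hk : 2 ≤ k) {A : Alloc k T} (hA : Online A)
    (hE : ExplorationSeparated A) {vmax δ ε : ℝ} (hv : 0 < vmax) (hδ0 : 0 ≤ δ)
    (hδ1 : δ ≤ 1 / 4) (hε0 : 0 ≤ ε) (hε1 : ε ≤ 1 / 4) :
    ∃ N : ℝ, δ * vmax * N ≤ worstGapRegret A vmax δ ∧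
      ε * vmax * (T * (3 / 8 - 32 * ε ^ 2 * N)) ≤ worstRegret A vmax := by
  have : NeZero k := ⟨by omega⟩
  set v : Fin k → ℝ := fun _ => vmax with hvdef
  obtain ⟨i, j, hij, hskip⟩ := exists_ne_skipped A v
    (show (⟨0, by omega⟩ : Fin k) ≠ ⟨1, by omega⟩ by simp)
  have hvb : PosBids v := fun _ => hv
  obtain ⟨ξ, hξ_iff⟩ : ∃ ξ : Fin T → Realization k T → Prop,
      ∀ t ρ, ξ t ρ ↔ MayInfluence A ρ t ∧ A v ρ t = j := ⟨_, fun _ _ => Iff.rfl⟩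
  have hξ : Predictable ξ := fun t ρ ρ' h => by
    simp only [hξ_iff, MayInfluence.congr h, hA.congr v h]
  refine ⟨unifWeight k T * ∑ ρ, ∑ t, if ξ t ρ then (1 : ℝ) else 0, ?_, ?_⟩
  · have hval := validValues_favoring hv hδ0 hδ1 i
    refine le_trans ?_ (regret_le_worstGapRegret A (validCTR_biasedCTR j le_rfl (by norm_num))
      hval (hasGap_favoring hv hδ0 hij))
    refine le_trans ?_ (sum_prob_mul_gap_le_regret A _ (sum_prob_biasedCTR j 0) i)
    simp only [mul_sum]
    refine sum_le_sum fun ρ _ => sum_le_sum fun t _ => ?_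
    have hp : prob (biasedCTR j 0) ρ = unifWeight k T := by
      rw [prob_biasedCTR]
      simp [tilt]
    have hμ : ∀ l, biasedCTR j 0 l = 1 / 2 := by simp [biasedCTR]
    rw [hp, hμ, hμ, mul_left_comm]
    refine mul_le_mul_of_nonneg_left ?_ unifWeight_pos.le
    have hδv := mul_nonneg hδ0 hv.le
    by_cases hx : ξ t ρ
    · have hAj : A (favoring vmax δ i) ρ t = j :=
        (((hξ_iff t ρ).1 hx).1.bid_independent hA hE (fun l => (hval l).1) hvb).trans
          ((hξ_iff t ρ).1 hx).2
      simp only [hx, if_true, hAj, favoring, hij.symm, if_false]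
      linarith
    · simp only [hx, if_false, favoring, if_true]
      split_ifs <;> linarith
  · have hcm := change_of_measure hε0 hε1 hξ j
      (h := fun ρ => ∑ t, if A v ρ t = j then (0 : ℝ) else 1) (H := T)
      (fun ρ => sum_nonneg fun t _ => by split_ifs <;> norm_num)
      (fun ρ => by
        calc (∑ t, if A v ρ t = j then (0 : ℝ) else 1) ≤ ∑ _t : Fin T, (1 : ℝ) :=
              sum_le_sum fun t _ => by split_ifs <;> norm_num
          _ = T := by simp)
      (fun t ρ hx => by simp only [alloc_flip_eq hA hvb ((hξ_iff t ρ).not.1 hx)])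
    refine le_trans ?_ (regret_le_worstRegret A (validCTR_biasedCTR j hε0 hε1)
      (v := v) fun _ => ⟨hv, le_rfl⟩)
    refine le_trans ?_ (sum_prob_mul_gap_le_regret A v (sum_prob_biasedCTR j ε) j)
    have hgap : ∀ ρ : Realization k T, ∑ t, (biasedCTR j ε j * v j -
        biasedCTR j ε (A v ρ t) * v (A v ρ t)) =
        ε * vmax * ∑ t, if A v ρ t = j then (0 : ℝ) else 1 := by
      intro ρ
      rw [mul_sum]
      refine sum_congr rfl fun t _ => ?_
      by_cases hj : A v ρ t = j
      · simp [hj]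
      · rw [if_neg hj, biasedCTR, biasedCTR, if_pos rfl, if_neg hj]
        ring
    simp only [hgap, mul_left_comm _ (ε * vmax), ← mul_sum]
    refine mul_le_mul_of_nonneg_left ?_ (mul_nonneg hε0 hv.le)
    linarith

end Regret

/-- If a family of exploration-separated deterministic allocation rules
has worst-case regret `O(vmax · T^γ)` with `γ < 1`, then for every `δ ∈ (0,1/4]` and every
`λ < 2(1-γ)` its worst-case `δ`-gap regret is `Ω(δ · vmax · T^λ)`. -/
theorem gap_regret_lower_bound (k : ℕ) (hk : 2 ≤ k) (vmax : ℝ) (hv : 0 < vmax)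
    (A : ∀ T : ℕ, Alloc k T)
    (hOn : ∀ T, Online (A T)) (hES : ∀ T, ExplorationSeparated (A T))
    (C γ : ℝ) (hγ : γ < 1)
    (hub : ∀ T : ℕ, worstRegret (A T) vmax ≤ C * vmax * (T : ℝ) ^ γ) :
    ∀ δ lam : ℝ, 0 < δ → δ ≤ 1 / 4 → lam < 2 * (1 - γ) →
      ∃ c : ℝ, 0 < c ∧ ∃ T₀ : ℕ, ∀ T : ℕ, T₀ ≤ T →
        c * δ * vmax * (T : ℝ) ^ lam ≤ worstGapRegret (A T) vmax δ := by
  intro δ lam hδ0 hδ1 hlam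
  set l := max lam 0 with hl
  have hl0 : 0 ≤ l := le_max_right _ _
  have hlγ : 0 < 1 - l / 2 - γ := by
    have : l < 2 * (1 - γ) := max_lt hlam (by linarith)
    linarith
  obtain ⟨T₁, hT₁⟩ := Filter.eventually_atTop.1
    (((tendsto_rpow_atTop hlγ).comp tendsto_natCast_atTop_atTop).eventually_gt_atTop (16 * C))
  refine ⟨1 / 16, by norm_num, max T₁ 1, fun T hT => ?_⟩
  have hbig : 16 * C < (T : ℝ) ^ (1 - l / 2 - γ) := hT₁ T (le_of_max_le_left hT)
  have hT1 : (1 : ℝ) ≤ T := by exact_mod_cast le_of_max_le_right hT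
  have hTpos : (0 : ℝ) < T := by linarith
  set ε : ℝ := (T : ℝ) ^ (-(l / 2)) / 4 with hε
  have hε0 : 0 < ε := by positivity
  have hε1 : ε ≤ 1 / 4 := by
    have := Real.rpow_le_one_of_one_le_of_nonpos hT1 (show -(l / 2) ≤ 0 by linarith)
    linarith
  have hε2 : ε ^ 2 * (T : ℝ) ^ l = 1 / 16 := by
    have : ((T : ℝ) ^ (-(l / 2))) ^ 2 * (T : ℝ) ^ l = 1 := by
      rw [← Real.rpow_natCast, ← Real.rpow_mul hTpos.le, ← Real.rpow_add hTpos]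
      norm_num
    rw [hε, div_pow, div_mul_eq_mul_div, this]
    norm_num
  obtain ⟨N, hN, hR⟩ := exploration_tradeoff hk (hOn T) (hES T) hv hδ0.le hδ1 hε0.le hε1
  by_contra! hcon
  have hNl : N < 1 / 16 * (T : ℝ) ^ l := by
    have hlam_le : (T : ℝ) ^ lam ≤ (T : ℝ) ^ l :=
      Real.rpow_le_rpow_of_exponent_le hT1 (le_max_left _ _)
    have h1 : δ * vmax * N < δ * vmax * (1 / 16 * (T : ℝ) ^ lam) := by linarith
    have := lt_of_mul_lt_mul_left h1 (by positivity)
    linarith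
  have hKL : 32 * ε ^ 2 * N ≤ 1 / 8 := by
    have := mul_le_mul_of_nonneg_left hNl.le (sq_nonneg ε)
    linarith
  have hlow : ε * vmax * (T * (1 / 4)) ≤ C * vmax * (T : ℝ) ^ γ := by
    refine le_trans ?_ (hR.trans (hub T))
    refine mul_le_mul_of_nonneg_left ?_ (by positivity)
    refine mul_le_mul_of_nonneg_left ?_ hTpos.le
    linarith
  have hpow : ε * T = (T : ℝ) ^ (1 - l / 2 - γ) * (T : ℝ) ^ γ / 4 := by
    rw [hε, ← Real.rpow_add hTpos, div_mul_eq_mul_div]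
    nth_rewrite 2 [← Real.rpow_one (T : ℝ)]
    rw [← Real.rpow_add hTpos]
    ring_nf
  have hγpos : 0 < (T : ℝ) ^ γ := Real.rpow_pos_of_pos hTpos γ
  have := mul_lt_mul_of_pos_right hbig (mul_pos hv hγpos)
  have h2 : ε * vmax * (T * (1 / 4)) = vmax * (ε * T) / 4 := by ring
  rw [h2, hpow] at hlow
  linarith

end MAB
end
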